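/- Completeness: For any signature Σ = (V,E,{P_e}) and any formula φ ∈ Φ(Σ), if φ is not derivable in the proof system for Σ (⊬ φ), then there exists a protocol 𝒫 over Σ and a run r of 𝒫 such that r ⊮ φ. -/

import Mathlib

/- Formulas of the language Φ(Σ): atoms are indexed by a type `P` of
propositional symbols; `edgeOf p` is the unique edge `e` with `p ∈ P_e`
(this encodes a pairwise disjoint family `{P_e}_{e ∈ E}`). -/
inductive Form (E P : Type) : Type
  | bot : Form E P
  | atom : P → Form E P
  | imp : Form E P → Form E P → Form E P
  | box : E → Form E P → Form E P

namespace Form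
/-- ¬φ abbreviates φ → ⊥. -/
def neg {E P : Type} (φ : Form E P) : Form E P := imp φ bot
/-- φ ∨ ψ abbreviates ¬φ → ψ. -/
def or {E P : Type} (φ ψ : Form E P) : Form E P := imp (neg φ) ψ
end Form

/-- An undirected multigraph is given by `inc : E → V × V` sending each edge to
its (two, possibly equal) ends.  `Incident inc e v` says `v` is an end of `e`. -/
def Incident {V E : Type} (inc : E → V × V) (e : E) (v : V) : Prop :=
  (inc e).1 = v ∨ (inc e).2 = v

/-- Adjacency using only edges from the set `S`. -/
def AdjVia {V E : Type} (inc : E → V × V) (S : Set E) (u v : V) : Prop :=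
  ∃ e ∈ S, inc e = (u, v) ∨ inc e = (v, u)

/-- Reachability using only edges from the set `S`. -/
def ReachableVia {V E : Type} (inc : E → V × V) (S : Set E) : V → V → Prop :=
  Relation.ReflTransGen (AdjVia inc S)

/-- The graph is connected. -/
def ConnectedGraph {V E : Type} (inc : E → V × V) : Prop :=
  ∀ u v : V, ReachableVia inc Set.univ u v

/-- A path `e₀, v₁, e₁, …, v_k, e_k`: distinct edges, distinct vertices, with
`e_i, e_{i+1}` incident to `v_{i+1}` for `0 ≤ i < k`. -/
structure GPath (V E : Type) (inc : E → V × V) where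
  edges : List E
  verts : List V
  len_eq : edges.length = verts.length + 1
  edges_nodup : edges.Nodup
  verts_nodup : verts.Nodup
  incid_left : ∀ i (hi : i < verts.length),
    Incident inc (edges.get ⟨i, by omega⟩) (verts.get ⟨i, hi⟩)
  incid_right : ∀ i (hi : i < verts.length),
    Incident inc (edges.get ⟨i + 1, by omega⟩) (verts.get ⟨i, hi⟩)

/-- `g` is a gateway between `A` and `B`: every path that starts with an edge
in `A` and ends with an edge in `B` contains the edge `g`. -/
def IsGateway {V E : Type} (inc : E → V × V) (A B : Set E) (g : E) : Prop :=
  ∀ p : GPath V E inc, ∀ hne : p.edges ≠ [],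
    p.edges.head hne ∈ A → p.edges.getLast hne ∈ B → g ∈ p.edges

/-- The sublanguage Φ(Σ,T). -/
inductive InLang {E P : Type} (edgeOf : P → E) (T : Set E) : Form E P → Prop
  | bot : InLang edgeOf T Form.bot
  | atom (p : P) : edgeOf p ∈ T → InLang edgeOf T (Form.atom p)
  | imp {φ ψ : Form E P} : InLang edgeOf T φ → InLang edgeOf T ψ →
      InLang edgeOf T (Form.imp φ ψ)
  | box (t : E) (φ : Form E P) : t ∈ T → InLang edgeOf T (Form.box t φ)

/-- Evaluation of a formula under a truth assignment `v` that treats atoms and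
boxed formulas as atomic. -/
def evalWith {E P : Type} (v : Form E P → Prop) : Form E P → Prop
  | Form.bot => False
  | Form.imp φ ψ => evalWith v φ → evalWith v ψ
  | φ => v φ

/-- Propositional tautology. -/
def Tautology {E P : Type} (φ : Form E P) : Prop := ∀ v, evalWith v φ

/-- The proof system: propositional tautologies, Truth, Positive Introspection,
Negative Introspection, Distributivity, Gateway; Modus Ponens, Necessitation. -/
inductive Deriv {V E P : Type} (inc : E → V × V) (edgeOf : P → E) : Form E P → Prop
  | taut {φ : Form E P} : Tautology φ → Deriv inc edgeOf φ
  | truth (e : E) (φ : Form E P) : Deriv inc edgeOf (Form.imp (Form.box e φ) φ)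
  | posIntro (e : E) (φ : Form E P) :
      Deriv inc edgeOf (Form.imp (Form.box e φ) (Form.box e (Form.box e φ)))
  | negIntro (e : E) (φ : Form E P) :
      Deriv inc edgeOf (Form.imp (Form.neg (Form.box e φ)) (Form.box e (Form.neg (Form.box e φ))))
  | distrib (e : E) (φ ψ : Form E P) :
      Deriv inc edgeOf (Form.imp (Form.box e (Form.imp φ ψ))
        (Form.imp (Form.box e φ) (Form.box e ψ)))
  | gateway {A B : Set E} {g e : E} {φ ψ : Form E P} :
      IsGateway inc A B g → e ∈ A → InLang edgeOf A φ → InLang edgeOf B ψ →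
      Deriv inc edgeOf (Form.imp (Form.box e (Form.imp φ ψ)) (Form.imp φ (Form.box g ψ)))
  | mp {φ ψ : Form E P} : Deriv inc edgeOf (Form.imp φ ψ) → Deriv inc edgeOf φ →
      Deriv inc edgeOf ψ
  | nec (e : E) {φ : Form E P} : Deriv inc edgeOf φ → Deriv inc edgeOf (Form.box e φ)

/-- `X ⊢ φ`: derivable from assumptions `X` using theorems of the system and
Modus Ponens only. -/
inductive DerivFrom {V E P : Type} (inc : E → V × V) (edgeOf : P → E)
    (X : Set (Form E P)) : Form E P → Prop
  | ax {φ : Form E P} : Deriv inc edgeOf φ → DerivFrom inc edgeOf X φ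
  | hyp {φ : Form E P} : φ ∈ X → DerivFrom inc edgeOf X φ
  | mp {φ ψ : Form E P} : DerivFrom inc edgeOf X (Form.imp φ ψ) →
      DerivFrom inc edgeOf X φ → DerivFrom inc edgeOf X ψ

/-- A protocol over the signature: a set of values `W e` for each channel `e`,
local conditions `L v` at each vertex, and a valuation `π`. -/
structure Protocol {V E P : Type} (inc : E → V × V) (edgeOf : P → E) where
  W : E → Type
  L : (v : V) → Set ((e : {e : E // Incident inc e v}) → W e.1)
  pi : (p : P) → Set (W (edgeOf p))

/-- A run of a protocol. -/
def IsRun {V E P : Type} {inc : E → V × V} {edgeOf : P → E}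
    (Pr : Protocol inc edgeOf) (r : (e : E) → Pr.W e) : Prop :=
  ∀ v : V, (fun e : {e : E // Incident inc e v} => r e.1) ∈ Pr.L v

def Run {V E P : Type} {inc : E → V × V} {edgeOf : P → E}
    (Pr : Protocol inc edgeOf) : Type :=
  {r : (e : E) → Pr.W e // IsRun Pr r}

/-- Satisfaction `r ⊩ φ`. -/
def Sat {V E P : Type} {inc : E → V × V} {edgeOf : P → E}
    (Pr : Protocol inc edgeOf) : Run Pr → Form E P → Prop
  | _, Form.bot => False
  | r, Form.atom p => r.1 (edgeOf p) ∈ Pr.pi p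
  | r, Form.imp φ ψ => Sat Pr r φ → Sat Pr r ψ
  | r, Form.box e φ => ∀ r' : Run Pr, r'.1 e = r.1 e → Sat Pr r' φ

section DerivFrom

variable {V E P : Type} {inc : E → V × V} {edgeOf : P → E}

lemma DerivFrom.mono {X Y : Set (Form E P)} (h : X ⊆ Y) {φ : Form E P}
    (hd : DerivFrom inc edgeOf X φ) : DerivFrom inc edgeOf Y φ := by
  induction hd with
  | ax h => exact .ax h
  | hyp hx => exact .hyp (h hx)
  | mp _ _ ih₁ ih₂ => exact .mp ih₁ ih₂

lemma DerivFrom.taut {X : Set (Form E P)} {φ : Form E P} (h : Tautology φ) :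
    DerivFrom inc edgeOf X φ :=
  .ax (.taut h)

lemma DerivFrom.deriv {φ : Form E P} (hd : DerivFrom inc edgeOf ∅ φ) : Deriv inc edgeOf φ := by
  induction hd with
  | ax h => exact h
  | hyp hx => exact hx.elim
  | mp _ _ ih₁ ih₂ => exact .mp ih₁ ih₂

/-- The deduction theorem. -/
lemma DerivFrom.deduction {X : Set (Form E P)} {φ ψ : Form E P}
    (hd : DerivFrom inc edgeOf (insert φ X) ψ) : DerivFrom inc edgeOf X (.imp φ ψ) := by
  induction hd with
  | ax h => exact .mp (.taut (by intro v; simp only [evalWith]; tauto)) (.ax h)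
  | hyp hx =>
    rcases hx with rfl | hx
    · exact .taut (by intro v; simp only [evalWith]; tauto)
    · exact .mp (.taut (by intro v; simp only [evalWith]; tauto)) (.hyp hx)
  | mp _ _ ih₁ ih₂ =>
    exact .mp (.mp (.taut (by intro v; simp only [evalWith]; tauto)) ih₁) ih₂

/-- Assumptions from a set closed under finite conjunctions can be merged into one. -/
lemma DerivFrom.exists_imp_of_union {S Z : Set (Form E P)} (htop : Form.neg .bot ∈ S)
    (hand : ∀ α ∈ S, ∀ β ∈ S, Form.neg (.imp α (Form.neg β)) ∈ S) {ψ : Form E P}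
    (hd : DerivFrom inc edgeOf (S ∪ Z) ψ) : ∃ α ∈ S, DerivFrom inc edgeOf Z (.imp α ψ) := by
  induction hd with
  | ax h =>
    exact ⟨_, htop, .mp (.taut (by intro v; simp only [evalWith]; tauto)) (.ax h)⟩
  | @hyp φ hx =>
    rcases hx with hx | hx
    · exact ⟨φ, hx, .taut (by intro v; simp only [evalWith]; tauto)⟩
    · exact ⟨_, htop, .mp (.taut (by intro v; simp only [evalWith]; tauto)) (.hyp hx)⟩
  | mp _ _ ih₁ ih₂ =>
    obtain ⟨α, hα, h₁⟩ := ih₁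
    obtain ⟨β, hβ, h₂⟩ := ih₂
    refine ⟨_, hand α hα β hβ, .mp (.mp (.taut ?_) h₁) h₂⟩
    intro v
    simp only [evalWith, Form.neg]
    tauto

lemma DerivFrom.exists_mem_of_sUnion {c : Set (Set (Form E P))} (hc : IsChain (· ⊆ ·) c)
    (hne : c.Nonempty) {φ : Form E P} (hd : DerivFrom inc edgeOf (⋃₀ c) φ) :
    ∃ X ∈ c, DerivFrom inc edgeOf X φ := by
  induction hd with
  | ax h => exact ⟨_, hne.some_mem, .ax h⟩
  | hyp hx =>
    obtain ⟨X, hX, hx⟩ := hx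
    exact ⟨X, hX, .hyp hx⟩
  | mp _ _ ih₁ ih₂ =>
    obtain ⟨X, hX, h₁⟩ := ih₁
    obtain ⟨Y, hY, h₂⟩ := ih₂
    rcases hc.total hX hY with h | h
    · exact ⟨Y, hY, .mp (h₁.mono h) h₂⟩
    · exact ⟨X, hX, .mp h₁ (h₂.mono h)⟩

end DerivFrom

/-- Maximal consistent sets of formulas. -/
structure MaxConsistent {V E P : Type} (inc : E → V × V) (edgeOf : P → E)
    (M : Set (Form E P)) : Prop where
  consistent : ¬ DerivFrom inc edgeOf M .bot
  mem_or_neg_mem : ∀ φ : Form E P, φ ∈ M ∨ φ.neg ∈ M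

/-- The formulas known at the edge `e` according to `M`. -/
def knownAt {E P : Type} (e : E) (M : Set (Form E P)) : Set (Form E P) :=
  {ψ | Form.box e ψ ∈ M}

section MaxConsistent

variable {V E P : Type} {inc : E → V × V} {edgeOf : P → E}

/-- Lindenbaum's lemma. -/
lemma exists_maxConsistent_superset {X : Set (Form E P)}
    (hX : ¬ DerivFrom inc edgeOf X .bot) : ∃ M, X ⊆ M ∧ MaxConsistent inc edgeOf M := by
  obtain ⟨M, hXM, hM⟩ := zorn_subset_nonempty {Y | ¬ DerivFrom inc edgeOf Y .bot}
    (fun c hc hchain hne => ⟨⋃₀ c, fun hd => by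
      obtain ⟨Y, hY, hd⟩ := hd.exists_mem_of_sUnion hchain hne
      exact hc hY hd, fun _ => Set.subset_sUnion_of_mem⟩) X hX
  have key : ∀ φ ∉ M, DerivFrom inc edgeOf M φ.neg := fun φ hφ => by
    by_contra hd
    refine hφ (hM.2 (y := insert φ M) (fun h => hd h.deduction) (Set.subset_insert _ _) ?_)
    exact Set.mem_insert _ _
  refine ⟨M, hXM, hM.1, fun φ => ?_⟩
  by_contra! h
  exact hM.1 (.mp (key _ h.2) (key _ h.1))

namespace MaxConsistent

variable {M N : Set (Form E P)}

lemma mem_of_derivFrom (hM : MaxConsistent inc edgeOf M) {φ : Form E P}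
    (hd : DerivFrom inc edgeOf M φ) : φ ∈ M :=
  (hM.mem_or_neg_mem φ).resolve_right fun h => hM.consistent (.mp (.hyp h) hd)

lemma mem_of_deriv (hM : MaxConsistent inc edgeOf M) {φ : Form E P}
    (hd : Deriv inc edgeOf φ) : φ ∈ M :=
  hM.mem_of_derivFrom (.ax hd)

lemma mem_of_imp (hM : MaxConsistent inc edgeOf M) {φ ψ : Form E P}
    (hd : Deriv inc edgeOf (.imp φ ψ)) (hφ : φ ∈ M) : ψ ∈ M :=
  hM.mem_of_derivFrom (.mp (.ax hd) (.hyp hφ))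

lemma bot_notMem (hM : MaxConsistent inc edgeOf M) : Form.bot ∉ M :=
  fun h => hM.consistent (.hyp h)

lemma neg_mem_iff (hM : MaxConsistent inc edgeOf M) {φ : Form E P} : φ.neg ∈ M ↔ φ ∉ M :=
  ⟨fun h h' => hM.consistent (.mp (.hyp h) (.hyp h')), (hM.mem_or_neg_mem φ).resolve_left⟩

lemma imp_mem_iff (hM : MaxConsistent inc edgeOf M) {φ ψ : Form E P} :
    Form.imp φ ψ ∈ M ↔ (φ ∈ M → ψ ∈ M) := by
  refine ⟨fun h h' => hM.mem_of_derivFrom (.mp (.hyp h) (.hyp h')), fun h => ?_⟩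
  by_cases hφ : φ ∈ M
  · exact hM.mem_of_imp (.taut (by intro v; simp only [evalWith]; tauto)) (h hφ)
  · exact hM.mem_of_imp (.taut (by intro v; simp only [evalWith, Form.neg]; tauto))
      (hM.neg_mem_iff.2 hφ)

lemma knownAt_subset (hM : MaxConsistent inc edgeOf M) (e : E) : knownAt e M ⊆ M :=
  fun ψ h => hM.mem_of_imp (.truth e ψ) h

lemma atom_mem_knownAt_iff (hM : MaxConsistent inc edgeOf M) (p : P) :
    Form.atom p ∈ knownAt (edgeOf p) M ↔ Form.atom p ∈ M := by
  refine ⟨fun h => hM.knownAt_subset _ h, fun h => ?_⟩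
  have hg : IsGateway inc {edgeOf p} {edgeOf p} (edgeOf p) := fun q hne hq _ => by
    rw [Set.mem_singleton_iff] at hq
    exact hq ▸ List.head_mem hne
  refine hM.mem_of_imp (.mp (.gateway hg rfl (.atom p rfl) (.atom p rfl)) (.nec _ (.taut ?_))) h
  intro v
  simp only [evalWith]
  tauto

lemma mem_knownAt_of_derivFrom (hM : MaxConsistent inc edgeOf M) {e : E} {φ : Form E P}
    (hd : DerivFrom inc edgeOf (knownAt e M) φ) : φ ∈ knownAt e M := by
  induction hd with
  | ax h => exact hM.mem_of_deriv (.nec e h)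
  | hyp h => exact h
  | mp _ _ ih₁ ih₂ => exact hM.imp_mem_iff.1 (hM.mem_of_imp (.distrib e _ _) ih₁) ih₂

lemma knownAt_eq_of_subset (hM : MaxConsistent inc edgeOf M) (hN : MaxConsistent inc edgeOf N)
    {e : E} (h : knownAt e M ⊆ N) : knownAt e N = knownAt e M := by
  ext ψ
  refine ⟨fun hψ => ?_, fun hψ => h (hM.mem_of_imp (.posIntro e ψ) hψ)⟩
  by_contra hc
  have : Form.neg (.box e ψ) ∈ N := h (hM.mem_of_imp (.negIntro e ψ) (hM.neg_mem_iff.2 hc))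
  exact hN.neg_mem_iff.1 this hψ

lemma exists_notMem_of_notMem_knownAt (hM : MaxConsistent inc edgeOf M) {e : E} {φ : Form E P}
    (h : φ ∉ knownAt e M) :
    ∃ N, MaxConsistent inc edgeOf N ∧ knownAt e N = knownAt e M ∧ φ ∉ N := by
  obtain ⟨N, hsub, hN⟩ := exists_maxConsistent_superset (inc := inc) (edgeOf := edgeOf)
    (X := insert φ.neg (knownAt e M)) fun hd => h <| hM.mem_knownAt_of_derivFrom <|
      .mp (.taut (by intro v; simp only [evalWith, Form.neg]; tauto)) hd.deduction
  exact ⟨N, hN, knownAt_eq_of_subset hM hN ((Set.subset_insert _ _).trans hsub),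
    hN.neg_mem_iff.1 (hsub (Set.mem_insert _ _))⟩

lemma inter_inLang_closed (hM : MaxConsistent inc edgeOf M) (A : Set E) :
    Form.neg .bot ∈ M ∩ {φ | InLang edgeOf A φ} ∧
    ∀ α ∈ M ∩ {φ | InLang edgeOf A φ}, ∀ β ∈ M ∩ {φ | InLang edgeOf A φ},
      Form.neg (.imp α (Form.neg β)) ∈ M ∩ {φ | InLang edgeOf A φ} := by
  refine ⟨⟨hM.neg_mem_iff.2 hM.bot_notMem, .imp .bot .bot⟩, fun α hα β hβ =>
    ⟨?_, .imp (.imp hα.2 (.imp hβ.2 .bot)) .bot⟩⟩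
  rw [hM.neg_mem_iff, hM.imp_mem_iff, hM.neg_mem_iff]
  exact fun h => h hα.1 hβ.1

/-- Maximal consistent sets agreeing on a gateway can be amalgamated along it. -/
lemma exists_amalgam (hM : MaxConsistent inc edgeOf M) (hN : MaxConsistent inc edgeOf N)
    {A B : Set E} {g : E} (hg : IsGateway inc A B g) (hgA : g ∈ A)
    (h : knownAt g M = knownAt g N) :
    ∃ K, MaxConsistent inc edgeOf K ∧ (∀ e ∈ A, knownAt e K = knownAt e M) ∧
      ∀ e ∈ B, knownAt e K = knownAt e N := by
  obtain ⟨K, hsub, hK⟩ := exists_maxConsistent_superset (inc := inc) (edgeOf := edgeOf)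
    (X := (M ∩ {φ | InLang edgeOf A φ}) ∪ ((N ∩ {φ | InLang edgeOf B φ}) ∪ ∅)) fun hd => by
      obtain ⟨α, hα, hd⟩ := hd.exists_imp_of_union (hM.inter_inLang_closed A).1
        (hM.inter_inLang_closed A).2
      obtain ⟨β, hβ, hd⟩ := hd.exists_imp_of_union (hN.inter_inLang_closed B).1
        (hN.inter_inLang_closed B).2
      have hαβ : Deriv inc edgeOf (.imp α β.neg) :=
        .mp (.taut (by intro v; simp only [evalWith, Form.neg]; tauto)) hd.deriv
      have hbox : β.neg ∈ knownAt g M :=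
        hM.mem_of_imp (.mp (.gateway hg hgA hα.2 (.imp hβ.2 .bot)) (.nec g hαβ)) hα.1
      rw [h] at hbox
      exact hN.neg_mem_iff.1 (hN.knownAt_subset g hbox) hβ.1
  have agree : ∀ {L : Set (Form E P)} {T : Set E}, MaxConsistent inc edgeOf L →
      L ∩ {φ | InLang edgeOf T φ} ⊆ K → ∀ e ∈ T, knownAt e K = knownAt e L := by
    intro L T hL hLK e he
    ext ψ
    refine ⟨fun hψ => ?_, fun hψ => hLK ⟨hψ, .box e ψ he⟩⟩
    by_contra hc
    exact hK.neg_mem_iff.1 (hLK ⟨hL.neg_mem_iff.2 hc, .imp (.box e ψ he) .bot⟩) hψ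
  exact ⟨K, hK, agree hM (Set.subset_union_left.trans hsub),
    agree hN ((Set.subset_union_left.trans Set.subset_union_right).trans hsub)⟩

end MaxConsistent

end MaxConsistent

section Graph

variable {V E : Type} {inc : E → V × V}

lemma AdjVia.symm {S : Set E} {u v : V} (h : AdjVia inc S u v) : AdjVia inc S v u := by
  obtain ⟨e, he, h⟩ := h
  exact ⟨e, he, h.symm⟩

lemma ReachableVia.symm {S : Set E} {u v : V} (h : ReachableVia inc S u v) :
    ReachableVia inc S v u := by
  induction h with
  | refl => exact .refl
  | tail _ hbc ih => exact .head hbc.symm ih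

lemma Incident.reachableVia {S : Set E} {e : E} (he : e ∈ S) {u v : V}
    (hu : Incident inc e u) (hv : Incident inc e v) : ReachableVia inc S u v := by
  rcases hu with rfl | rfl <;> rcases hv with rfl | rfl
  · exact .refl
  · exact .single ⟨e, he, .inl rfl⟩
  · exact .single ⟨e, he, .inr rfl⟩
  · exact .refl

lemma Incident.of_inc_eq {g : E} {u v : V} (h : inc g = (u, v) ∨ inc g = (v, u)) :
    Incident inc g u ∧ Incident inc g v := by
  rcases h with h | h <;> simp [Incident, h]

/-- A function that is constant on the ends of each edge of `S` is constant along paths in `S`. -/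
lemma ReachableVia.apply_eq {α : Type*} {f : V → α} {S : Set E}
    (hf : ∀ e ∈ S, ∀ a b, Incident inc e a → Incident inc e b → f a = f b) {u v : V}
    (h : ReachableVia inc S u v) : f u = f v := by
  induction h with
  | refl => rfl
  | tail _ hbc ih =>
    obtain ⟨e, he, hbc⟩ := hbc
    have hi := Incident.of_inc_eq hbc
    exact ih.trans (hf e he _ _ hi.1 hi.2)

/-- A bridge is a gateway between its two sides. -/
lemma isGateway_of_not_reachableVia {g : E} {u v : V} (h : ¬ ReachableVia inc {g}ᶜ u v) :
    IsGateway inc {f | f = g ∨ ∀ a, Incident inc f a → ReachableVia inc {g}ᶜ u a}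
      {f | f = g ∨ ∀ a, Incident inc f a → ReachableVia inc {g}ᶜ v a} g := by
  intro p hne hhead hlast
  by_contra hg
  have ne_g : ∀ f ∈ p.edges, f ≠ g := fun f hf h => hg (h ▸ hf)
  have key : ∀ i (hi : i < p.edges.length), ∀ a, Incident inc p.edges[i] a →
      ReachableVia inc {g}ᶜ u a := by
    intro i
    induction i with
    | zero =>
      intro hi
      rw [List.getElem_zero]
      exact hhead.resolve_left (ne_g _ (List.head_mem hne))
    | succ i ih =>
      intro hi a ha
      have hlen := p.len_eq
      have hi' : i < p.verts.length := by omega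
      exact (ih (by omega) _ (p.incid_left i hi')).trans
        (Incident.reachableVia (ne_g _ (List.getElem_mem hi)) (p.incid_right i hi') ha)
  rw [List.getLast_eq_getElem] at hlast
  have hlt : p.edges.length - 1 < p.edges.length := by
    have := p.len_eq
    omega
  have hinc : Incident inc p.edges[p.edges.length - 1] (inc p.edges[p.edges.length - 1]).1 :=
    .inl rfl
  exact h ((key _ hlt _ hinc).trans
    (hlast.resolve_left (ne_g _ (List.getElem_mem hlt)) _ hinc).symm)

end Graph

section Canonical

/-- Worlds of the canonical model: a set of formulas together with a counter for each edge. -/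
abbrev World (E P : Type) : Type := Set (Form E P) × (E →₀ Set (Form E P) →₀ ℤ)

/-- The value of the edge `e` at a world. A step along `e` may change `M` to a set `M'` that knows
the same at `e`, if the counter of `e` is shifted by the difference of the generators
of `M'` and `M`. -/
noncomputable def edgeValue {E P : Type} (e : E) (w : World E P) : World E P :=
  (knownAt e w.1, w.2 - Finsupp.single e (Finsupp.single w.1 1))

/-- The canonical protocol. -/
noncomputable def canonicalProtocol {V E P : Type} (inc : E → V × V) (edgeOf : P → E) :
    Protocol inc edgeOf where
  W _ := World E P
  L _ := {l | ∃ w, MaxConsistent inc edgeOf w.1 ∧ ∀ e, l e = edgeValue e.1 w}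
  pi p := {a | Form.atom p ∈ a.1}

/-- Truth of a formula when the edges know the given sets of formulas. -/
def localTruth {E P : Type} (edgeOf : P → E) (k : E → Set (Form E P)) : Form E P → Prop
  | .bot => False
  | .atom p => .atom p ∈ k (edgeOf p)
  | .imp φ ψ => localTruth edgeOf k φ → localTruth edgeOf k ψ
  | .box e φ => φ ∈ k e

/-- The edges of the atoms outside modalities and of the outermost modalities of a formula. -/
def Form.topEdges {E P : Type} (edgeOf : P → E) : Form E P → List E
  | .bot => []
  | .atom p => [edgeOf p]
  | .imp φ ψ => φ.topEdges edgeOf ++ ψ.topEdges edgeOf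
  | .box e _ => [e]

/-- `u` and `v` are not separated by any single edge. -/
def TwoEdgeConnected {V E : Type} (inc : E → V × V) (u v : V) : Prop :=
  ∀ g, ReachableVia inc {g}ᶜ u v

/-- `M` knows the same as the worlds `w u` at all edges incident to a vertex `u` of `U`, where `U`
is a union of classes of two-edge-connected vertices that is not separated by any edge leaving
it. -/
structure Amalgamates {V E P : Type} (inc : E → V × V) (w : V → World E P) (U : Set V)
    (M : Set (Form E P)) : Prop where
  closed : ∀ a ∈ U, ∀ b, TwoEdgeConnected inc a b → b ∈ U
  reachable : ∀ g c, Incident inc g c → c ∉ U → ∀ a ∈ U, ∀ b ∈ U, ReachableVia inc {g}ᶜ a b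
  agree : ∀ u ∈ U, ∀ e, Incident inc e u → knownAt e M = knownAt e (w u).1

variable {V E P : Type} {inc : E → V × V} {edgeOf : P → E}

lemma TwoEdgeConnected.refl (u : V) : TwoEdgeConnected inc u u := fun _ => .refl

lemma TwoEdgeConnected.symm {u v : V} (h : TwoEdgeConnected inc u v) :
    TwoEdgeConnected inc v u :=
  fun g => (h g).symm

lemma TwoEdgeConnected.trans {u v x : V} (h : TwoEdgeConnected inc u v)
    (h' : TwoEdgeConnected inc v x) : TwoEdgeConnected inc u x :=
  fun g => (h g).trans (h' g)

lemma MaxConsistent.mem_iff_localTruth {M : Set (Form E P)} (hM : MaxConsistent inc edgeOf M)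
    {k : E → Set (Form E P)} (φ : Form E P)
    (h : ∀ e ∈ φ.topEdges edgeOf, knownAt e M = k e) : φ ∈ M ↔ localTruth edgeOf k φ := by
  induction φ with
  | bot => exact iff_of_false hM.bot_notMem id
  | atom p =>
    rw [← hM.atom_mem_knownAt_iff p, h (edgeOf p) (by simp [Form.topEdges])]
    rfl
  | imp φ ψ ih₁ ih₂ =>
    rw [hM.imp_mem_iff, ih₁ fun e he => h e (by simp [Form.topEdges, he]),
      ih₂ fun e he => h e (by simp [Form.topEdges, he])]
    rfl
  | box e φ =>
    change φ ∈ knownAt e M ↔ φ ∈ k e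
    rw [h e (by simp [Form.topEdges])]

/-- A step along `e` does not change the counters of other edges. -/
lemma counter_eq_of_edgeValue_eq {e g : E} (hne : e ≠ g) {w w' : World E P}
    (h : edgeValue e w = edgeValue e w') : w.2 g = w'.2 g := by
  have hg := DFunLike.congr_fun (congrArg Prod.snd h) g
  simpa [edgeValue, Finsupp.single_eq_of_ne hne.symm] using hg

/-- The sum of all counters, minus the generator of the current set, is preserved by all steps. -/
lemma sum_sub_single_eq_of_edgeValue_eq {e : E} {w w' : World E P}
    (h : edgeValue e w = edgeValue e w') :
    (w.2.sum fun _ a => a) - Finsupp.single w.1 1 =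
      (w'.2.sum fun _ a => a) - Finsupp.single w'.1 1 := by
  have hs := congrArg (fun a : World E P => a.2.sum fun _ b => b) h
  simpa [edgeValue, Finsupp.sum_sub_index] using hs

/-- Two-edge-connected vertices carry the same set of formulas. -/
lemma TwoEdgeConnected.fst_eq {w : V → World E P}
    (hw : ∀ e a b, Incident inc e a → Incident inc e b → edgeValue e (w a) = edgeValue e (w b))
    (hconn : ConnectedGraph inc) {u v : V} (h : TwoEdgeConnected inc u v) :
    (w u).1 = (w v).1 := by
  have hx : (w u).2 = (w v).2 := by
    ext1 g
    exact (h g).apply_eq (f := fun a => (w a).2 g) fun e he a b ha hb =>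
      counter_eq_of_edgeValue_eq he (hw e a b ha hb)
  have hs := (hconn u v).apply_eq
    (f := fun a => ((w a).2.sum fun _ b => b) - Finsupp.single (w a).1 1)
    fun e _ a b ha hb => sum_sub_single_eq_of_edgeValue_eq (hw e a b ha hb)
  rw [hx, sub_right_inj] at hs
  exact Finsupp.single_left_injective one_ne_zero hs

lemma amalgamates_twoEdgeConnected {w : V → World E P}
    (hw : ∀ e a b, Incident inc e a → Incident inc e b → edgeValue e (w a) = edgeValue e (w b))
    (hconn : ConnectedGraph inc) (v : V) :
    Amalgamates inc w {a | TwoEdgeConnected inc v a} (w v).1 where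
  closed _ ha _ hb := ha.trans hb
  reachable g _ _ _ _ ha _ hb := (ha.symm.trans hb) g
  agree _ hu e _ := by rw [TwoEdgeConnected.fst_eq hw hconn hu]

lemma Amalgamates.exists_insert {w : V → World E P}
    (hw : ∀ e a b, Incident inc e a → Incident inc e b → edgeValue e (w a) = edgeValue e (w b))
    (hmc : ∀ v, MaxConsistent inc edgeOf (w v).1) (hconn : ConnectedGraph inc)
    {U : Set V} {M : Set (Form E P)} (hM : MaxConsistent inc edgeOf M)
    (hU : Amalgamates inc w U M) {u v : V} (hu : u ∈ U) (huv : AdjVia inc Set.univ u v) :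
    ∃ U' N, U ⊆ U' ∧ v ∈ U' ∧ MaxConsistent inc edgeOf N ∧ Amalgamates inc w U' N := by
  by_cases hvU : v ∈ U
  · exact ⟨U, M, subset_rfl, hvU, hM, hU⟩
  obtain ⟨g, -, hg⟩ := huv
  obtain ⟨hgu, hgv⟩ := Incident.of_inc_eq hg
  have hbr : ¬ ReachableVia inc {g}ᶜ u v := fun h => hvU <| hU.closed u hu v fun f => by
    by_cases hfg : g = f
    · exact hfg ▸ h
    · exact Incident.reachableVia hfg hgu hgv
  obtain ⟨N, hN, hA, hB⟩ := hM.exists_amalgam (hmc v) (isGateway_of_not_reachableVia hbr)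
    (.inl rfl) ((hU.agree u hu g hgu).trans (congrArg Prod.fst (hw g u v hgu hgv)))
  refine ⟨U ∪ {a | TwoEdgeConnected inc v a}, N, Set.subset_union_left,
    .inr (TwoEdgeConnected.refl v), hN, ⟨?_, ?_, ?_⟩⟩
  · rintro a (ha | ha) b hb
    · exact .inl (hU.closed a ha b hb)
    · exact .inr (ha.trans hb)
  · intro f c hc hcU
    have hgf : g ≠ f := by
      rintro rfl
      refine hcU ?_
      rcases hg with hg | hg <;> simp only [Incident, hg] at hc <;> rcases hc with rfl | rfl <;>
        first | exact .inl hu | exact .inr (TwoEdgeConnected.refl _)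
    have hfrom : ∀ a ∈ U ∪ {a | TwoEdgeConnected inc v a}, ReachableVia inc {f}ᶜ u a := by
      rintro a (ha | ha)
      · exact hU.reachable f c hc (fun h => hcU (.inl h)) u hu a ha
      · exact (Incident.reachableVia hgf hgu hgv).trans (ha f)
    exact fun a ha b hb => (hfrom a ha).symm.trans (hfrom b hb)
  · rintro a (ha | ha) e he
    · refine (hA e (or_iff_not_imp_left.2 fun hne b hb => ?_)).trans (hU.agree a ha e he)
      exact (hU.reachable g v hgv hvU u hu a ha).trans (Incident.reachableVia hne he hb)
    · rw [← TwoEdgeConnected.fst_eq hw hconn ha]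
      refine hB e (or_iff_not_imp_left.2 fun hne b hb => ?_)
      exact (ha g).trans (Incident.reachableVia hne he hb)

/-- Finitely many ends of edges can be amalgamated into one maximal consistent set. -/
lemma exists_amalgamates {w : V → World E P}
    (hw : ∀ e a b, Incident inc e a → Incident inc e b → edgeValue e (w a) = edgeValue e (w b))
    (hmc : ∀ v, MaxConsistent inc edgeOf (w v).1) (hconn : ConnectedGraph inc) (v : V)
    (l : List V) :
    ∃ U M, v ∈ U ∧ (∀ a ∈ l, a ∈ U) ∧ MaxConsistent inc edgeOf M ∧ Amalgamates inc w U M := by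
  induction l with
  | nil =>
    exact ⟨_, _, TwoEdgeConnected.refl v, by simp, hmc v, amalgamates_twoEdgeConnected hw hconn v⟩
  | cons t l ih =>
    obtain ⟨U, M, hv, hl, hM, hU⟩ := ih
    have key : ∃ U' N, U ⊆ U' ∧ t ∈ U' ∧ MaxConsistent inc edgeOf N ∧ Amalgamates inc w U' N := by
      have hvt := hconn v t
      induction hvt with
      | refl => exact ⟨U, M, subset_rfl, hv, hM, hU⟩
      | tail _ hbc ih =>
        obtain ⟨U₁, N₁, hsub, hb, hN₁, hU₁⟩ := ih
        obtain ⟨U₂, N₂, hsub₂, hc, hN₂, hU₂⟩ := hU₁.exists_insert hw hmc hconn hN₁ hb hbc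
        exact ⟨U₂, N₂, hsub.trans hsub₂, hc, hN₂, hU₂⟩
    obtain ⟨U', N, hsub, ht, hN, hU'⟩ := key
    exact ⟨U', N, hsub hv, List.forall_mem_cons.2 ⟨ht, fun a ha => hsub (hl a ha)⟩, hN, hU'⟩

/-- What an edge knows in a run of the canonical protocol is true in that run. -/
lemma localTruth_of_known (hconn : ConnectedGraph inc) (r : Run (canonicalProtocol inc edgeOf))
    {e : E} {φ : Form E P} (h : φ ∈ (r.1 e).1) : localTruth edgeOf (fun f => (r.1 f).1) φ := by
  choose w hmc hrw using r.2
  have hr : ∀ f a, Incident inc f a → r.1 f = edgeValue f (w a) := fun f a hf => hrw a ⟨f, hf⟩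
  have hw : ∀ f a b, Incident inc f a → Incident inc f b →
      edgeValue f (w a) = edgeValue f (w b) := fun f a b ha hb => (hr f a ha).symm.trans (hr f b hb)
  obtain ⟨U, M, he, hl, hM, hU⟩ := exists_amalgamates hw hmc hconn (inc e).1
    ((φ.topEdges edgeOf).map fun f => (inc f).1)
  have agree : ∀ f, (inc f).1 ∈ U → knownAt f M = (r.1 f).1 := fun f hf =>
    (hU.agree _ hf f (.inl rfl)).trans (congrArg Prod.fst (hr f _ (.inl rfl))).symm
  refine (hM.mem_iff_localTruth φ fun f hf => agree f (hl _ (List.mem_map_of_mem hf))).1 ?_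
  exact hM.knownAt_subset e ((agree e he).symm ▸ h)

/-- The run in which every vertex carries the same world. -/
noncomputable def constRun (w : World E P) (hw : MaxConsistent inc edgeOf w.1) :
    Run (canonicalProtocol inc edgeOf) :=
  ⟨fun e => edgeValue e w, fun _ => ⟨w, hw, fun _ => rfl⟩⟩

/-- The truth lemma. -/
lemma sat_iff_localTruth (hconn : ConnectedGraph inc) (φ : Form E P)
    (r : Run (canonicalProtocol inc edgeOf)) :
    Sat (canonicalProtocol inc edgeOf) r φ ↔ localTruth edgeOf (fun f => (r.1 f).1) φ := by
  induction φ generalizing r with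
  | bot => rfl
  | atom p => rfl
  | imp φ ψ ih₁ ih₂ => exact imp_congr (ih₁ r) (ih₂ r)
  | box e φ ih =>
    change (∀ r' : Run (canonicalProtocol inc edgeOf), r'.1 e = r.1 e →
      Sat (canonicalProtocol inc edgeOf) r' φ) ↔ φ ∈ (r.1 e).1
    refine ⟨fun h => ?_, fun h r' hr' => (ih r').2 (localTruth_of_known hconn r' (hr' ▸ h))⟩
    by_contra hφ
    obtain ⟨w, hmc, hw⟩ := r.2 (inc e).1
    have hre : r.1 e = edgeValue e w := hw ⟨e, .inl rfl⟩
    rw [hre] at hφ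
    obtain ⟨N, hN, hNw, hφN⟩ := hmc.exists_notMem_of_notMem_knownAt hφ
    let w' : World E P := (N, w.2 - Finsupp.single e (Finsupp.single w.1 1) +
      Finsupp.single e (Finsupp.single N 1))
    have hw' : edgeValue e w' = edgeValue e w := Prod.ext hNw (add_sub_cancel_right _ _)
    refine hφN ((hN.mem_iff_localTruth φ fun _ _ => rfl).2 ((ih (constRun w' hN)).1 ?_))
    exact h _ (hw'.trans hre.symm)

end Canonical

/-- Completeness: if ⊬ φ, then there exist a protocol 𝒫 over the
signature and a run r of 𝒫 such that r ⊮ φ. -/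
theorem completeness {V E P : Type} (inc : E → V × V) (edgeOf : P → E)
    (hconn : ConnectedGraph inc) (φ : Form E P)
    (hnd : ¬ Deriv inc edgeOf φ) :
    ∃ (Pr : Protocol inc edgeOf) (r : Run Pr), ¬ Sat Pr r φ := by
  obtain ⟨M, hsub, hM⟩ := exists_maxConsistent_superset (inc := inc) (edgeOf := edgeOf)
    (X := insert φ.neg ∅) fun hd => hnd <|
      .mp (.taut (by intro v; simp only [evalWith, Form.neg]; tauto)) hd.deduction.deriv
  refine ⟨canonicalProtocol inc edgeOf, constRun (M, 0) hM, fun h => ?_⟩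
  refine hM.neg_mem_iff.1 (hsub (Set.mem_insert _ _)) ?_
  exact (hM.mem_iff_localTruth φ fun _ _ => rfl).2 ((sat_iff_localTruth hconn φ _).1 h)
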